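/- An n-form ω on ℝ^{2n+1} satisfies (j¹φ)*ω = 0 for every smooth function φ: ℝⁿ → ℝ if and only if ω belongs to the ideal of the exterior algebra generated by c and dc, i.e. if and only if ω = c ∧ γ + dc ∧ δ for some (n−1)-form γ and some (n−2)-form δ on ℝ^{2n+1}. -/

import Mathlib

noncomputable section

namespace MA

/-- Points / tangent vectors of ℝ^m. -/
abbrev Vec (m : ℕ) := Fin m → ℝ

/-- An (unbundled) differential `k`-form on ℝ^m : at each point it eats a
`k`-tuple of tangent vectors and returns a real number. -/
abbrev Form (m k : ℕ) := Vec m → (Fin k → Vec m) → ℝ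

/-- `ω` is pointwise an alternating multilinear map, i.e. a genuine exterior form. -/
def IsForm {m k : ℕ} (ω : Form m k) : Prop :=
  ∀ x : Vec m, ∃ a : AlternatingMap ℝ (Vec m) ℝ (Fin k), ∀ v, ω x v = a v

/-- Smoothness of a differential form (smoothness of all coefficients). -/
def SmoothForm {m k : ℕ} (ω : Form m k) : Prop :=
  ∀ v : Fin k → Vec m, ContDiff ℝ (⊤ : ℕ∞) fun x => ω x v

/-- Multiplication of a form by a scalar function. -/
def fsmul {m k : ℕ} (f : Vec m → ℝ) (ω : Form m k) : Form m k := fun x v => f x * ω x v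

/-- Wedge (exterior) product of differential forms. -/
def wedge {m k l : ℕ} (ω : Form m k) (η : Form m l) : Form m (k + l) := fun x v =>
  ((k.factorial * l.factorial : ℕ) : ℝ)⁻¹ *
    ∑ σ : Equiv.Perm (Fin (k + l)),
      ((Equiv.Perm.sign σ : ℤ) : ℝ) *
        (ω x fun i => v (σ (Fin.castAdd l i))) *
        (η x fun j => v (σ (Fin.natAdd k j)))

/-- Interior product (contraction) of a form with a (constant) vector. -/
def iprod {m : ℕ} (u : Vec m) : ∀ {k : ℕ}, Form m k → Form m (k - 1)
  | 0, _ => 0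
  | _ + 1, ω => fun x v => ω x (Fin.cons u v)

/-- Exterior derivative of a differential form (coordinate formula). -/
def exd {m k : ℕ} (ω : Form m k) : Form m (k + 1) := fun x v =>
  ∑ i : Fin (k + 1),
    (-1 : ℝ) ^ (i : ℕ) * fderiv ℝ (fun y => ω y fun j => v (i.succAbove j)) x (v i)

/-- Change the (propositionally equal) degree of a form. -/
def reindex {m k l : ℕ} (h : k = l) (ω : Form m k) : Form m l :=
  fun x v => ω x fun i => v (Fin.cast h i)

/-- Pullback of a differential form along a map. -/
def pullback {a b k : ℕ} (f : Vec a → Vec b) (ω : Form b k) : Form a k :=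
  fun x v => ω (f x) fun i => fderiv ℝ f x (v i)

/-- `i`-th standard basis vector of ℝ^m. -/
def basisVec {m : ℕ} (i : Fin m) : Vec m := Pi.single i 1

/-- The coordinate 1-form `dx^i`. -/
def dx {m : ℕ} (i : Fin m) : Form m 1 := fun _ v => v 0 i

/-- Partial derivative of a function in the `i`-th coordinate direction. -/
def pd {m : ℕ} (i : Fin m) (f : Vec m → ℝ) : Vec m → ℝ := fun x => fderiv ℝ f x (basisVec i)

/- Jet-space coordinates on J¹ℝⁿ = ℝ^{2n+1} : (q¹,…,qⁿ,u,p₁,…,pₙ). -/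

/-- Index of the coordinate `q^μ`. -/
def qIdx {n : ℕ} (μ : Fin n) : Fin (2 * n + 1) := ⟨μ, by have := μ.isLt; omega⟩

/-- Index of the coordinate `u`. -/
def uIdx {n : ℕ} : Fin (2 * n + 1) := ⟨n, by omega⟩

/-- Index of the coordinate `p_μ`. -/
def pIdx {n : ℕ} (μ : Fin n) : Fin (2 * n + 1) := ⟨n + 1 + μ, by have := μ.isLt; omega⟩

/-- The Reeb field `χ = ∂/∂u` (a constant vector field). -/
def chi {n : ℕ} : Vec (2 * n + 1) := basisVec uIdx

/-- The standard contact form `c = du - Σ p_μ dq^μ` on J¹ℝⁿ. -/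
def contact {n : ℕ} : Form (2 * n + 1) 1 := fun x v =>
  v 0 uIdx - ∑ μ : Fin n, x (pIdx μ) * v 0 (qIdx μ)

/-- The symplectic-type 2-form `Ω = dc = Σ dq^μ ∧ dp_μ`. -/
def symp {n : ℕ} : Form (2 * n + 1) 2 := ∑ μ : Fin n, wedge (dx (qIdx μ)) (dx (pIdx μ))

/-- The bottom operator `⊥ = Σ_μ ∂_{p_μ} ⌟ ∂_{q^μ} ⌟ ·` (zero on forms of degree ≤ 1). -/
def botOp {n k : ℕ} (ω : Form (2 * n + 1) k) : Form (2 * n + 1) (k - 2) :=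
  ∑ μ : Fin n, iprod (basisVec (pIdx μ)) (iprod (basisVec (qIdx μ)) ω)

/-- A form is effective if it is killed by `χ ⌟ ·` and by `⊥`. -/
def Effective {n k : ℕ} (ω : Form (2 * n + 1) k) : Prop :=
  iprod (chi (n := n)) ω = 0 ∧ botOp ω = 0

/-- The projection `p(α) = α - c ∧ (χ ⌟ α)` onto forms annihilated by `χ ⌟ ·`. -/
def proj {n : ℕ} : ∀ {k : ℕ}, Form (2 * n + 1) k → Form (2 * n + 1) k
  | 0, α => α
  | j + 1, α => α - reindex (Nat.add_comm 1 j) (wedge contact (iprod (chi (n := n)) α))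

/-- The projected exterior derivative `d_p = p ∘ d`. -/
def dproj {n k : ℕ} (ω : Form (2 * n + 1) k) : Form (2 * n + 1) (k + 1) := proj (exd ω)

/-- Lie derivative along the (constant) Reeb field `χ`. -/
def lieChi {n k : ℕ} (ω : Form (2 * n + 1) k) : Form (2 * n + 1) k := fun x v =>
  fderiv ℝ (fun y => ω y v) x (chi (n := n))

/-- The Euler operator `E = d_p ∘ ⊥ ∘ d_p + L_χ` on n-forms over J¹ℝⁿ. -/
def euler : ∀ {n : ℕ}, Form (2 * n + 1) n → Form (2 * n + 1) n
  | 0, ω => lieChi ω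
  | n + 1, ω =>
    reindex (show n + 1 + 1 - 2 + 1 = n + 1 by omega) (dproj (botOp (dproj ω))) + lieChi ω

/-- The horizontal volume form `β = dq¹ ∧ … ∧ dqⁿ` on J¹ℝⁿ. -/
def qvol {n : ℕ} : Form (2 * n + 1) n := fun _ v =>
  Matrix.det (Matrix.of fun i j : Fin n => v i (qIdx j))

/-- The volume form `β = dq¹ ∧ … ∧ dqⁿ` on the base ℝⁿ. -/
def baseVol {n : ℕ} : Form n n := fun _ v => Matrix.det (Matrix.of fun i j : Fin n => v i j)

/-- `β_μ = ∂_{q^μ} ⌟ β`. -/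
def betaMu {n : ℕ} (μ : Fin n) : Form (2 * n + 1) (n - 1) := iprod (basisVec (qIdx μ)) qvol

/-- The first jet prolongation `j¹φ : ℝⁿ → ℝ^{2n+1}`, `x ↦ (x, φ(x), ∂₁φ(x), …, ∂ₙφ(x))`. -/
def jet {n : ℕ} (φ : Vec n → ℝ) (x : Vec n) : Vec (2 * n + 1) := fun i =>
  if h : (i : ℕ) < n then x ⟨i, h⟩
  else if h2 : (i : ℕ) = n then φ x
  else fderiv ℝ φ x (basisVec ⟨(i : ℕ) - (n + 1), by have := i.isLt; omega⟩)

/-- Second partial derivative `φ_{μν} = ∂²φ/∂q^μ∂q^ν`. -/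
def d2 {n : ℕ} (φ : Vec n → ℝ) (μ ν : Fin n) : Vec n → ℝ := fun x =>
  fderiv ℝ (fun y => fderiv ℝ φ y (basisVec ν)) x (basisVec μ)

/-- A form is multisymplectic if it is closed and pointwise nondegenerate. -/
def Multisymplectic {m k : ℕ} (μ : Form m k) : Prop :=
  exd μ = 0 ∧ ∀ (x v : Vec m), iprod v μ x = 0 → v = 0

/-- Lift a form on J¹ℝⁿ = ℝ^{2n+1} to ℝ^{2n+2} = J¹ℝⁿ × ℝ (extra coordinate `e`)
along the projection. -/
def liftForm {n k : ℕ} (ω : Form (2 * n + 1) k) : Form (2 * n + 1 + 1) k :=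
  pullback (fun y (i : Fin (2 * n + 1)) => y i.castSucc) ω

/-- The 1-form `de` on ℝ^{2n+2}. -/
def deForm {n : ℕ} : Form (2 * n + 1 + 1) 1 := dx (Fin.last (2 * n + 1))

/-- The (n+1)-form `m_ω = de ∧ β + c ∧ ω` on ℝ^{2n+2}. -/
def msf {n : ℕ} (ω : Form (2 * n + 1) n) : Form (2 * n + 1 + 1) (n + 1) :=
  reindex (Nat.add_comm 1 n) (wedge (deForm (n := n)) (liftForm qvol)) +
    reindex (Nat.add_comm 1 n) (wedge (liftForm (contact (n := n))) (liftForm ω))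

open Function in
/-- A primitive `m`-linear alternating function (in the slots `A`, with respect to the symplectic
pairs `q i, p i` for `i ∈ R`) which vanishes on the Lagrangian graphs
`q i + ∑ j, S i j • p j`, `S` symmetric, vanishes on all tuples of basis vectors. -/
theorem eq_zero_of_effective_of_graphs {X Y U : Type*} [Fintype X] [Nonempty X] [DecidableEq X]
    [DecidableEq Y] [AddCommGroup U] [Module ℝ U] (q p : X → U) (m : ℕ) :
    ∀ (A : Finset Y) (R : Finset X) (M : (Y → U) → ℝ), A.card = m → R.card = m →
    (∀ a ∈ A, ∀ v x y, M (update v a (x + y)) = M (update v a x) + M (update v a y)) →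
    (∀ v, ∀ a ∈ A, ∀ b ∈ A, a ≠ b → v a = v b → M v = 0) →
    (∀ a ∈ A, ∀ b ∈ A, a ≠ b → ∀ v, ∑ i ∈ R, M (update (update v a (q i)) b (p i)) = 0) →
    (∀ S : X → X → ℝ, (∀ i j, S i j = S j i) → (∀ i j, i ∉ R → S i j = 0) →
      ∀ β : Y → X, Set.BijOn β A R → ∀ v,
        (∀ a ∈ A, v a = q (β a) + ∑ j, S (β a) j • p j) → M v = 0) →
    ∀ v, (∀ a ∈ A, ∃ i ∈ R, v a = q i ∨ v a = p i) → M v = 0 := by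
  induction m using Nat.strong_induction_on with
  | _ m ih =>
  intro A R M hA hR hadd halt heff hgraph
  have hswap : ∀ a ∈ A, ∀ b ∈ A, a ≠ b → ∀ v x y,
      M (update (update v a x) b y) = - M (update (update v a y) b x) := by
    intro a ha b hb hab v x y
    have hz : ∀ x, M (update (update v a x) b x) = 0 := fun x =>
      halt _ a ha b hb hab (by simp [hab])
    have h := hz (x + y)
    rw [hadd b hb, update_comm hab, update_comm hab, hadd a ha, hadd a ha, update_comm hab.symm,
      update_comm hab.symm, update_comm hab.symm, update_comm hab.symm, hz, hz] at h
    linarith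
  have hsingle : ∀ a ∈ A, ∀ i ∈ R, ∀ z, (z = q i ∨ z = p i) → ∀ v,
      (∀ a' ∈ A.erase a, ∃ i' ∈ R.erase i, v a' = q i' ∨ v a' = p i') →
      M (update v a z) = 0 := by
    intro a ha i hi z hz
    have hm : 0 < m := hA ▸ Finset.card_pos.2 ⟨a, ha⟩
    refine ih (m - 1) (by omega) (A.erase a) (R.erase i) (fun v => M (update v a z))
      (by rw [Finset.card_erase_of_mem ha, hA]) (by rw [Finset.card_erase_of_mem hi, hR]) ?_ ?_ ?_ ?_
    · intro b hb v x y
      obtain ⟨hba, hb⟩ := Finset.mem_erase.1 hb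
      simp only [update_comm hba, hadd b hb]
    · intro v b hb c hc hbc h
      obtain ⟨hba, hb⟩ := Finset.mem_erase.1 hb
      obtain ⟨hca, hc⟩ := Finset.mem_erase.1 hc
      exact halt _ b hb c hc hbc (by simp [hba, hca, h])
    · intro b hb c hc hbc v
      obtain ⟨hba, hb⟩ := Finset.mem_erase.1 hb
      obtain ⟨hca, hc⟩ := Finset.mem_erase.1 hc
      have h := heff b hb c hc hbc (update v a z)
      rw [← Finset.add_sum_erase _ _ hi] at h
      have h0 : M (update (update (update v a z) b (q i)) c (p i)) = 0 := by
        rcases hz with rfl | rfl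
        · exact halt _ a ha b hb hba.symm (by simp [hba.symm, hca.symm, hbc])
        · exact halt _ a ha c hc hca.symm (by simp [hba.symm, hca.symm])
      rw [h0, zero_add] at h
      simpa only [update_comm hca, update_comm hba] using h
    · intro S hS hS0 β hβ v hv
      have hβ' : Set.BijOn (update β a i) A R := by
        have h := (hβ.congr (f₂ := update β a i) (fun b hb => by
          rw [update_of_ne (Finset.mem_erase.1 hb).1])).insert (a := a) (by simp)
        rwa [update_self, ← Finset.coe_insert, ← Finset.coe_insert, Finset.insert_erase ha,
          Finset.insert_erase hi] at h
      have key : ∀ t : ℝ, M (update v a (q i + t • p i)) = 0 := by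
        intro t
        refine hgraph (fun j k => S j k + if j = i ∧ k = i then t else 0)
          (fun j k => by rw [hS j k]; simp only [and_comm]) (fun j k hj => ?_) _ hβ' _ ?_
        · have : j ≠ i := fun h => hj (h ▸ hi)
          simp [hS0 j k (by simp [hj]), this]
        · intro b hb
          by_cases hba : b = a
          · subst hba
            simp [hS0, ite_smul]
          · have hb' : b ∈ A.erase a := Finset.mem_erase.2 ⟨hba, hb⟩
            have : β b ≠ i := (Finset.mem_erase.1 (hβ.1 hb')).1
            simp [hba, this, hv b hb']
      have h0 := key 0
      have h1 := key 1
      simp only [zero_smul, add_zero, one_smul] at h0 h1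
      rw [hadd a ha, h0, zero_add] at h1
      rcases hz with rfl | rfl
      · exact h0
      · exact h1
  have hpair : ∀ a ∈ A, ∀ b ∈ A, a ≠ b → ∀ d ∈ R, ∀ h ∈ R, d ≠ h → ∀ v,
      (∀ a' ∈ (A.erase a).erase b, ∃ i' ∈ (R.erase d).erase h, v a' = q i' ∨ v a' = p i') →
      M (update (update v a (q d)) b (p d)) - M (update (update v a (q h)) b (p h)) = 0 := by
    intro a ha b hb hab d hd h hh hdh
    have hb' : b ∈ A.erase a := Finset.mem_erase.2 ⟨hab.symm, hb⟩
    have hh' : h ∈ R.erase d := Finset.mem_erase.2 ⟨hdh.symm, hh⟩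
    have hm : 0 < m := hA ▸ Finset.card_pos.2 ⟨a, ha⟩
    refine ih (m - 1 - 1) (by omega) ((A.erase a).erase b) ((R.erase d).erase h)
      (fun v => M (update (update v a (q d)) b (p d)) - M (update (update v a (q h)) b (p h)))
      (by rw [Finset.card_erase_of_mem hb', Finset.card_erase_of_mem ha, hA])
      (by rw [Finset.card_erase_of_mem hh', Finset.card_erase_of_mem hd, hR]) ?_ ?_ ?_ ?_
    · intro c hc v x y
      simp only [Finset.mem_erase] at hc
      obtain ⟨hcb, hca, hc⟩ := hc
      simp only [update_comm hca, update_comm hcb, hadd c hc]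
      ring
    · intro v c hc e he hce hv
      simp only [Finset.mem_erase] at hc he
      rw [halt _ c hc.2.2 e he.2.2 hce (by simp [hc, he, hv]),
        halt _ c hc.2.2 e he.2.2 hce (by simp [hc, he, hv]), sub_zero]
    · intro c hc e he hce v
      simp only [Finset.mem_erase] at hc he
      obtain ⟨hcb, hca, hc⟩ := hc
      obtain ⟨heb, hea, he⟩ := he
      have h1 := heff c hc e he hce (update (update v a (q d)) b (p d))
      have h2 := heff c hc e he hce (update (update v a (q h)) b (p h))
      rw [← Finset.add_sum_erase _ _ hd, ← Finset.add_sum_erase _ _ hh'] at h1 h2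
      rw [halt _ a ha c hc hca.symm (by simp [hca.symm, hea.symm, hab, hce])] at h1
      rw [halt (update (update (update (update v a (q h)) b (p h)) c (q h)) e (p h)) a ha c hc
        hca.symm (by simp [hca.symm, hea.symm, hab, hce])] at h2
      have h3 : M (update (update (update (update v a (q d)) b (p d)) c (q h)) e (p h)) =
          M (update (update (update (update v a (q h)) b (p h)) c (q d)) e (p d)) := by
        have perm : ∀ x y z w, update (update (update (update v a x) b y) c z) e w =
            update (update (update (update v b y) e w) a x) c z := fun x y z w => by
          rw [update_comm hab, update_comm hce, update_comm hea.symm]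
        rw [update_comm hcb.symm, hswap b hb e he heb.symm, update_comm hcb, perm,
          hswap a ha c hc hca.symm, ← perm, neg_neg]
      simp only [update_comm hca, update_comm hcb, update_comm hea, update_comm heb,
        Finset.sum_sub_distrib]
      linarith
    · intro S hS hS0 β hβ v hv
      have hβ' : Set.BijOn (update (update β b h) a d) A R := by
        have h1 := (hβ.congr (f₂ := update (update β b h) a d) (fun c hc => by
          have := (Finset.mem_erase.1 (Finset.mem_erase.1 hc).2).1
          have := (Finset.mem_erase.1 hc).1
          simp [*])).insert (a := b) (by simp [hab.symm])
        rw [update_of_ne hab.symm, update_self, ← Finset.coe_insert, ← Finset.coe_insert,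
          Finset.insert_erase hb', Finset.insert_erase hh'] at h1
        have h2 := h1.insert (a := a) (by simp)
        rwa [update_self, ← Finset.coe_insert, ← Finset.coe_insert, Finset.insert_erase ha,
          Finset.insert_erase hd] at h2
      have key : ∀ t : ℝ, M (update (update v a (q d + t • p h)) b (q h + t • p d)) = 0 := by
        intro t
        refine hgraph (fun j k => S j k + ((if j = d ∧ k = h then t else 0) +
            if j = h ∧ k = d then t else 0))
          (fun j k => ?_) (fun j k hj => ?_) _ hβ' _ ?_
        · rw [hS j k, add_comm (ite _ _ _)]
          simp only [and_comm]
        · have h1 : j ≠ d := fun h => hj (h ▸ hd)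
          have h2 : j ≠ h := fun h => hj (h ▸ hh)
          simp [hS0 j k (by simp [hj]), h1, h2]
        · intro c hc
          by_cases hca : c = a
          · subst hca
            simp [hS0, ite_smul, hdh, hab]
          by_cases hcb : c = b
          · subst hcb
            simp [hS0, ite_smul, hdh.symm, hca]
          have hc' : c ∈ (A.erase a).erase b := by simp [*]
          have := hβ.1 hc'
          simp only [Finset.coe_erase, Set.mem_sdiff, Set.mem_singleton_iff] at this
          simp [hca, hcb, this, hv c hc']
      have expand : ∀ x y z w, M (update (update v a (x + y)) b (z + w)) =
          M (update (update v a x) b z) + M (update (update v a x) b w) +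
          M (update (update v a y) b z) + M (update (update v a y) b w) := by
        intro x y z w
        rw [hadd b hb]
        simp only [update_comm hab, hadd a ha]
        ring
      have hnegb : ∀ x z, M (update (update v a x) b (-z)) = -M (update (update v a x) b z) := by
        intro x z
        have h0 := hadd b hb (update v a x) 0 0
        have h1 := hadd b hb (update v a x) z (-z)
        rw [add_zero] at h0
        rw [add_neg_cancel] at h1
        linarith
      have hnega : ∀ x z, M (update (update v a (-x)) b z) = -M (update (update v a x) b z) := by
        intro x z
        rw [hswap a ha b hb hab, hnegb, hswap a ha b hb hab v x z]
      have k1 := key 1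
      have k2 := key (-1)
      simp only [one_smul, neg_smul, expand, hnega, hnegb] at k1 k2
      have k3 := hswap a ha b hb hab v (p h) (q h)
      linarith
  intro v hv
  have hv' : ∀ a, ∃ f : X × Bool, a ∈ A → f.1 ∈ R ∧ v a = if f.2 then p f.1 else q f.1 := by
    intro a
    by_cases ha : a ∈ A
    · obtain ⟨i, hi, h | h⟩ := hv a ha
      · exact ⟨(i, false), fun _ => ⟨hi, by simpa using h⟩⟩
      · exact ⟨(i, true), fun _ => ⟨hi, by simpa using h⟩⟩
    · exact ⟨(Classical.arbitrary X, false), fun h => absurd h ha⟩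
  choose f hf using hv'
  have hq : ∀ a ∈ A, v a = q (f a).1 ∨ v a = p (f a).1 := fun a ha => by
    have := (hf a ha).2
    split_ifs at this <;> simp [this]
  by_cases hinj : Set.InjOn f A
  swap
  · simp only [Set.InjOn, not_forall] at hinj
    obtain ⟨a, ha, b, hb, hab, hne⟩ := hinj
    exact halt v a ha b hb hne (by rw [(hf a ha).2, (hf b hb).2, hab])
  by_cases hs : ∃ a ∈ A, ∀ b ∈ A, f b ≠ ((f a).1, !(f a).2)
  · obtain ⟨a, ha, hab⟩ := hs
    rw [← update_eq_self a v]
    refine hsingle a ha (f a).1 (hf a ha).1 _ (hq a ha) v fun b hb => ?_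
    obtain ⟨hba, hb⟩ := Finset.mem_erase.1 hb
    refine ⟨(f b).1, Finset.mem_erase.2 ⟨fun h => ?_, (hf b hb).1⟩, hq b hb⟩
    by_cases h2 : (f b).2 = (f a).2
    · exact hba (hinj hb ha (Prod.ext h h2))
    · exact hab b hb (Prod.ext h (Bool.eq_not.2 h2))
  push Not at hs
  rcases A.eq_empty_or_nonempty with rfl | ⟨a₀, ha₀⟩
  · obtain rfl : R = ∅ := by rw [← Finset.card_eq_zero, hR, ← hA, Finset.card_empty]
    exact hgraph 0 (by simp) (by simp) (fun a => (f a).1) (by simp) v (by simp)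
  have hslot : ∀ c ∈ A, ∀ t : Bool, ∃ b ∈ A, f b = ((f c).1, t) := fun c hc t => by
    by_cases h : (f c).2 = t
    · exact ⟨c, hc, Prod.ext rfl h⟩
    · obtain ⟨b, hb, hbc⟩ := hs c hc
      exact ⟨b, hb, by rw [hbc, Bool.eq_not.2 (Ne.symm h)]⟩
  set d := (f a₀).1 with hd
  have hdR : d ∈ R := (hf a₀ ha₀).1
  obtain ⟨a, ha, hfa⟩ := hslot a₀ ha₀ false
  obtain ⟨b, hb, hfb⟩ := hslot a₀ ha₀ true
  have hab : a ≠ b := by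
    rintro rfl
    simp [hfa] at hfb
  have hva : v a = q d := by simpa [hfa] using (hf a ha).2
  have hvb : v b = p d := by simpa [hfb] using (hf b hb).2
  have hvd : update (update v a (q d)) b (p d) = v := by
    rw [← hva, update_eq_self, ← hvb, update_eq_self]
  have hterm : ∀ i ∈ R, M (update (update v a (q i)) b (p i)) =
      if i ≠ d ∧ ∃ c ∈ A, (f c).1 = i then 0 else M v := by
    intro i hi
    split_ifs with h
    · obtain ⟨hid, c, hc, rfl⟩ := h
      obtain ⟨e, he, hfe⟩ := hslot c hc false
      have hea : e ≠ a := by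
        rintro rfl
        exact hid (by rw [hfa] at hfe; exact (congrArg Prod.fst hfe).symm)
      have heb : e ≠ b := by
        rintro rfl
        rw [hfb] at hfe
        simp at hfe
      exact halt _ a ha e he hea.symm (by simp [hea, heb, hab, (hf e he).2, hfe])
    · by_cases hid : i = d
      · rw [hid, hvd]
      · have := hpair a ha b hb hab d hdR i hi (Ne.symm hid) v fun c hc => ?_
        · rw [hvd] at this
          linarith
        · simp only [Finset.mem_erase] at hc
          refine ⟨(f c).1, ?_, hq c hc.2.2⟩
          simp only [Finset.mem_erase]
          refine ⟨fun h' => h ⟨hid, c, hc.2.2, h'⟩, fun h' => ?_, (hf c hc.2.2).1⟩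
          rcases h2 : (f c).2 with _ | _
          · exact hc.2.1 (hinj hc.2.2 ha (hfa ▸ Prod.ext h' h2))
          · exact hc.1 (hinj hc.2.2 hb (hfb ▸ Prod.ext h' h2))
  have hsum := heff a ha b hb hab v
  classical
  rw [Finset.sum_congr rfl hterm, Finset.sum_ite, Finset.sum_const_zero, zero_add,
    Finset.sum_const, nsmul_eq_mul, mul_eq_zero] at hsum
  refine hsum.resolve_left ?_
  rw [Nat.cast_eq_zero, Finset.card_eq_zero]
  exact Finset.ne_empty_of_mem (a := d) (by simp [hdR])

section Wedge

open scoped Nat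

variable {V : Type*} [AddCommGroup V] [Module ℝ V] {k l : ℕ}

/-- The wedge product of alternating maps, normalised as `wedge`. -/
def wedgeAlt (a : V [⋀^Fin k]→ₗ[ℝ] ℝ) (b : V [⋀^Fin l]→ₗ[ℝ] ℝ) : V [⋀^Fin (k + l)]→ₗ[ℝ] ℝ :=
  ((k ! * l ! : ℕ) : ℝ)⁻¹ • MultilinearMap.alternatization
    (((LinearMap.mul' ℝ ℝ).compMultilinearMap
      (a.toMultilinearMap.domCoprod b.toMultilinearMap)).domDomCongr finSumFinEquiv)

theorem wedgeAlt_apply (a : V [⋀^Fin k]→ₗ[ℝ] ℝ) (b : V [⋀^Fin l]→ₗ[ℝ] ℝ) (v : Fin (k + l) → V) :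
    wedgeAlt a b v = ((k ! * l ! : ℕ) : ℝ)⁻¹ * ∑ σ : Equiv.Perm (Fin (k + l)),
      ((Equiv.Perm.sign σ : ℤ) : ℝ) * (a fun i => v (σ (Fin.castAdd l i))) *
        (b fun j => v (σ (Fin.natAdd k j))) := by
  simp only [wedgeAlt, AlternatingMap.smul_apply, MultilinearMap.alternatization_apply, smul_eq_mul]
  congr 1
  refine Finset.sum_congr rfl fun σ _ => ?_
  simp [Units.smul_def, mul_assoc]

theorem wedge_eq_wedgeAlt {m : ℕ} {ω : Form m k} {η : Form m l} {x : Vec m}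
    {a : Vec m [⋀^Fin k]→ₗ[ℝ] ℝ} {b : Vec m [⋀^Fin l]→ₗ[ℝ] ℝ}
    (ha : ∀ v, ω x v = a v) (hb : ∀ v, η x v = b v) (v : Fin (k + l) → Vec m) :
    wedge ω η x v = wedgeAlt a b v := by
  simp only [wedge, wedgeAlt_apply, ha, hb]

/-- `wedgeAlt a` as a linear map. -/
def wedgeAltLeft (l : ℕ) (a : V [⋀^Fin k]→ₗ[ℝ] ℝ) :
    (V [⋀^Fin l]→ₗ[ℝ] ℝ) →ₗ[ℝ] V [⋀^Fin (k + l)]→ₗ[ℝ] ℝ where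
  toFun := wedgeAlt a
  map_add' b b' := by
    ext v
    simp only [wedgeAlt_apply, AlternatingMap.add_apply, mul_add, Finset.sum_add_distrib]
  map_smul' c b := by
    ext v
    simp only [wedgeAlt_apply, AlternatingMap.smul_apply, smul_eq_mul, RingHom.id_apply,
      Finset.mul_sum]
    exact Finset.sum_congr rfl fun σ _ => by ring

variable {ι : Type*} (e : ι → V)

theorem sum_wedgeAlt_mul [Fintype ι] (a : V [⋀^Fin k]→ₗ[ℝ] ℝ) (b : V [⋀^Fin l]→ₗ[ℝ] ℝ)
    (g : V [⋀^Fin (k + l)]→ₗ[ℝ] ℝ) :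
    ∑ f : Fin (k + l) → ι, wedgeAlt a b (e ∘ f) * g (e ∘ f) =
      ((k ! * l ! : ℕ) : ℝ)⁻¹ * ((k + l)! * ∑ f₂ : Fin l → ι, b (e ∘ f₂) *
        ∑ f₁ : Fin k → ι, a (e ∘ f₁) * g (e ∘ Fin.append f₁ f₂)) := by
  simp only [wedgeAlt_apply, mul_assoc, Finset.sum_mul, ← Finset.mul_sum]
  congr 1
  rw [Finset.sum_comm]
  have key : ∀ σ : Equiv.Perm (Fin (k + l)), ∑ f : Fin (k + l) → ι,
      ((Equiv.Perm.sign σ : ℤ) : ℝ) * ((a fun i => (e ∘ f) (σ (Fin.castAdd l i))) *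
        ((b fun j => (e ∘ f) (σ (Fin.natAdd k j))) * g (e ∘ f))) =
      ∑ f₂ : Fin l → ι, b (e ∘ f₂) *
        ∑ f₁ : Fin k → ι, a (e ∘ f₁) * g (e ∘ Fin.append f₁ f₂) := by
    intro σ
    have h1 : ∀ f : Fin (k + l) → ι,
        ((Equiv.Perm.sign σ : ℤ) : ℝ) * ((a fun i => (e ∘ f) (σ (Fin.castAdd l i))) *
          ((b fun j => (e ∘ f) (σ (Fin.natAdd k j))) * g (e ∘ f))) =
        (fun f' : Fin (k + l) → ι => (a fun i => e (f' (Fin.castAdd l i))) *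
          ((b fun j => e (f' (Fin.natAdd k j))) * g (e ∘ f'))) (f ∘ σ) := by
      intro f
      have := g.map_perm (e ∘ f) σ
      simp only [Function.comp_assoc] at this
      simp only [Function.comp_apply, this, Units.smul_def, zsmul_eq_mul]
      ring
    rw [Finset.sum_congr rfl fun f _ => h1 f]
    refine (Equiv.sum_comp (Equiv.arrowCongr σ.symm (Equiv.refl ι)) (fun f' : Fin (k + l) → ι =>
      (a fun i => e (f' (Fin.castAdd l i))) *
        ((b fun j => e (f' (Fin.natAdd k j))) * g (e ∘ f')))).trans ?_
    rw [← Equiv.sum_comp (Fin.appendEquiv k l), Fintype.sum_prod_type, Finset.sum_comm]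
    refine Finset.sum_congr rfl fun f₂ _ => ?_
    rw [Finset.mul_sum]
    refine Finset.sum_congr rfl fun f₁ _ => ?_
    simp [Fin.appendEquiv, Function.comp_def]
    ring
  rw [Finset.sum_congr rfl fun σ _ => key σ]
  simp [Fintype.card_perm]

/-- The coordinates of an alternating map in a family of vectors. -/
def altCoords (k : ℕ) : (V [⋀^Fin k]→ₗ[ℝ] ℝ) →ₗ[ℝ] (Fin k → ι) → ℝ where
  toFun a f := a (e ∘ f)
  map_add' _ _ := rfl
  map_smul' _ _ := rfl

theorem altCoords_injective (b : Module.Basis ι ℝ V) :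
    Function.Injective (altCoords b k) := fun _ _ h =>
  Module.Basis.ext_alternating b fun v _ => congrFun h v

theorem exists_orthogonal_wedgeAlt [Fintype ι] (a : V [⋀^Fin k]→ₗ[ℝ] ℝ)
    (α : V [⋀^Fin (k + l)]→ₗ[ℝ] ℝ) :
    ∃ δ : V [⋀^Fin l]→ₗ[ℝ] ℝ, ∀ δ' : V [⋀^Fin l]→ₗ[ℝ] ℝ,
      ∑ f : Fin (k + l) → ι, wedgeAlt a δ' (e ∘ f) * (α - wedgeAlt a δ) (e ∘ f) = 0 := by
  let C : (V [⋀^Fin (k + l)]→ₗ[ℝ] ℝ) →ₗ[ℝ] EuclideanSpace ℝ (Fin (k + l) → ι) :=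
    (WithLp.linearEquiv 2 ℝ _).symm.toLinearMap ∘ₗ altCoords e (k + l)
  obtain ⟨y, ⟨δ, rfl⟩, z, hz, h⟩ := (LinearMap.range
    (C ∘ₗ wedgeAltLeft l a)).exists_add_mem_mem_orthogonal (C α)
  refine ⟨δ, fun δ' => ?_⟩
  have hzC : z = C (α - wedgeAlt a δ) := by
    rw [map_sub, h]
    simp [wedgeAltLeft]
  have := (Submodule.mem_orthogonal' _ _).1 hz _ ⟨δ', rfl⟩
  rw [hzC, PiLp.inner_apply] at this
  simpa [C, altCoords, wedgeAltLeft] using this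

end Wedge

section Symplectic

/-- The symplectic vector space `ℝ^{2n}`, with coordinates `(μ, false)` and `(μ, true)` standing
for `q^μ` and `p_μ`. -/
abbrev SympVec (n : ℕ) := Fin n × Bool → ℝ

/-- The basis vector `∂/∂q^μ` of `SympVec n`. -/
abbrev qVec {n : ℕ} (μ : Fin n) : SympVec n := Pi.single (μ, false) 1

/-- The basis vector `∂/∂p_μ` of `SympVec n`. -/
abbrev pVec {n : ℕ} (μ : Fin n) : SympVec n := Pi.single (μ, true) 1

/-- The symplectic form on `SympVec n`. -/
def sympAlt (n : ℕ) : SympVec n [⋀^Fin 2]→ₗ[ℝ] ℝ :=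
  ∑ μ : Fin n, Matrix.detRowAlternating.compLinearMap
    (LinearMap.pi ![LinearMap.proj (μ, false), LinearMap.proj (μ, true)])

theorem alternatingMap_sum_apply {V ι κ : Type*} [AddCommGroup V] [Module ℝ V] (s : Finset κ)
    (g : κ → V [⋀^ι]→ₗ[ℝ] ℝ) (v : ι → V) : (∑ i ∈ s, g i) v = ∑ i ∈ s, g i v := by
  classical
  induction s using Finset.induction_on with
  | empty => simp
  | insert i s hi ih => simp [Finset.sum_insert hi, ih]

theorem sympAlt_apply {n : ℕ} (v : Fin 2 → SympVec n) :
    sympAlt n v = ∑ μ, (v 0 (μ, false) * v 1 (μ, true) - v 0 (μ, true) * v 1 (μ, false)) := by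
  simp only [sympAlt, alternatingMap_sum_apply]
  refine Finset.sum_congr rfl fun μ _ => ?_
  exact (Matrix.det_fin_two _).trans (by simp)

variable {n k : ℕ}

/-- The contraction of an alternating map with the Poisson bivector. -/
def contractAlt (g : SympVec n [⋀^Fin (2 + k)]→ₗ[ℝ] ℝ) : SympVec n [⋀^Fin k]→ₗ[ℝ] ℝ :=
  ∑ μ, ((g.domDomCongr (finCongr (Nat.add_comm 2 k))).curryLeft (qVec μ)).curryLeft (pVec μ)

theorem append_pair_eq {α : Type*} (x y : α) (v : Fin k → α) (i : Fin (2 + k)) :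
    (Matrix.vecCons x (Matrix.vecCons y v) : Fin (k + 2) → α) (finCongr (Nat.add_comm 2 k) i) =
      Fin.append ![x, y] v i := by
  refine Fin.addCases (fun i => ?_) (fun i => ?_) i
  · rw [Fin.append_left]
    fin_cases i <;> rfl
  · have : finCongr (Nat.add_comm 2 k) (Fin.natAdd 2 i) = i.succ.succ := by
      ext
      simp [Nat.add_comm, Nat.add_left_comm]
    rw [this]
    simp

theorem contractAlt_apply (g : SympVec n [⋀^Fin (2 + k)]→ₗ[ℝ] ℝ) (v : Fin k → SympVec n) :
    contractAlt g v = ∑ μ, g (Fin.append ![qVec μ, pVec μ] v) := by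
  simp only [contractAlt, alternatingMap_sum_apply]
  refine Finset.sum_congr rfl fun μ _ => ?_
  simp only [AlternatingMap.curryLeft_apply_apply, AlternatingMap.domDomCongr_apply]
  congr 1
  ext1 i
  exact append_pair_eq _ _ _ _

theorem exists_perm_apply_eq {α : Type*} [DecidableEq α] {x y a b : α} (hxy : x ≠ y)
    (hab : a ≠ b) : ∃ σ : Equiv.Perm α, σ x = a ∧ σ y = b := by
  refine ⟨Equiv.swap x a * Equiv.swap y (Equiv.swap x a b), ?_, ?_⟩
  · have : x ≠ Equiv.swap x a b := fun h => hab (by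
      simpa using congrArg (Equiv.swap x a) h)
    simp [Equiv.swap_apply_of_ne_of_ne hxy this]
  · simp

theorem sum_update_eq_zero_of_contractAlt {g : SympVec n [⋀^Fin (2 + k)]→ₗ[ℝ] ℝ}
    (hg : contractAlt g = 0) {a b : Fin (2 + k)} (hab : a ≠ b) (v : Fin (2 + k) → SympVec n) :
    ∑ μ, g (Function.update (Function.update v a (qVec μ)) b (pVec μ)) = 0 := by
  obtain ⟨σ, hσa, hσb⟩ := exists_perm_apply_eq (x := Fin.castAdd k (0 : Fin 2))
    (y := Fin.castAdd k (1 : Fin 2)) (by simp [Fin.ext_iff]) hab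
  have key : ∀ μ : Fin n, g (Function.update (Function.update v a (qVec μ)) b (pVec μ)) =
      (Equiv.Perm.sign σ : ℤ) • g (Fin.append ![qVec μ, pVec μ] fun i => v (σ (Fin.natAdd 2 i))) := by
    intro μ
    have h : Fin.append ![qVec μ, pVec μ] (fun i => v (σ (Fin.natAdd 2 i))) =
        Function.update (Function.update v a (qVec μ)) b (pVec μ) ∘ σ := by
      ext1 i
      refine Fin.addCases (fun i => ?_) (fun i => ?_) i
      · fin_cases i
        · simp [hσa, hab]
        · simp [hσb]
      · have h1 : σ (Fin.natAdd 2 i) ≠ a := by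
          rw [← hσa, σ.injective.ne_iff]
          simp [Fin.ext_iff]
        have h2 : σ (Fin.natAdd 2 i) ≠ b := by
          rw [← hσb, σ.injective.ne_iff]
          simp [Fin.ext_iff]
          omega
        simp [h1, h2]
    rw [h, g.map_perm, Units.smul_def, smul_smul]
    simp
  rw [Finset.sum_congr rfl fun μ _ => key μ, ← Finset.smul_sum, ← contractAlt_apply, hg]
  simp

theorem sum_sympAlt_mul (G : (Fin 2 → Fin n × Bool) → ℝ)
    (hG : ∀ i j, G ![j, i] = - G ![i, j]) :
    ∑ f : Fin 2 → Fin n × Bool, sympAlt n (fun i => Pi.single (f i) 1) * G f =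
      2 * ∑ μ, G ![(μ, false), (μ, true)] := by
  rw [← Equiv.sum_comp (finTwoArrowEquiv _).symm, Fintype.sum_prod_type]
  simp only [sympAlt_apply, finTwoArrowEquiv_symm_apply, Matrix.cons_val_zero, Matrix.cons_val_one,
    Fintype.sum_prod_type, Finset.sum_mul, Fintype.sum_bool, Pi.single_apply, Prod.mk.injEq]
  simp [Finset.sum_add_distrib, hG (_, false) (_, true), two_mul]

theorem contractAlt_eq_zero_of_orthogonal {g : SympVec n [⋀^Fin (2 + k)]→ₗ[ℝ] ℝ}
    (hg : ∀ δ : SympVec n [⋀^Fin k]→ₗ[ℝ] ℝ, ∑ f : Fin (2 + k) → Fin n × Bool,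
      wedgeAlt (sympAlt n) δ ((fun i => Pi.single i 1) ∘ f) * g ((fun i => Pi.single i 1) ∘ f) = 0) :
    contractAlt g = 0 := by
  have h := hg (contractAlt g)
  rw [sum_wedgeAlt_mul] at h
  have key : ∀ f₂ : Fin k → Fin n × Bool, ∑ f₁ : Fin 2 → Fin n × Bool,
      sympAlt n ((fun i => Pi.single i 1) ∘ f₁) *
        g ((fun i => Pi.single i 1) ∘ Fin.append f₁ f₂) =
      2 * contractAlt g ((fun i => Pi.single i 1) ∘ f₂) := by
    intro f₂
    refine (sum_sympAlt_mul (fun f₁ => g ((fun i => Pi.single i 1) ∘ Fin.append f₁ f₂)) ?_).trans ?_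
    · intro i j
      rw [← g.map_swap _ (i := Fin.castAdd k 0) (j := Fin.castAdd k 1) (by simp [Fin.ext_iff])]
      congr 1
      ext1 x
      refine Fin.addCases (fun x => ?_) (fun x => ?_) x
      · fin_cases x <;> simp [Equiv.swap_apply_left, Equiv.swap_apply_right]
      · have h0 : Fin.natAdd 2 x ≠ Fin.castAdd k 0 := by simp [Fin.ext_iff]
        have h1 : Fin.natAdd 2 x ≠ Fin.castAdd k 1 := by simp [Fin.ext_iff]; omega
        simp [Equiv.swap_apply_of_ne_of_ne h0 h1]
    · rw [contractAlt_apply]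
      congr 1
      refine Finset.sum_congr rfl fun μ _ => ?_
      congr 1
      ext1 x
      refine Fin.addCases (fun x => ?_) (fun x => ?_) x
      · fin_cases x <;> simp
      · simp
  simp only [key] at h
  rw [mul_eq_zero, or_iff_right (by positivity), mul_eq_zero, or_iff_right (by positivity),
    Finset.sum_eq_zero_iff_of_nonneg fun f _ => by nlinarith [sq_nonneg (contractAlt g
      ((fun i => Pi.single i 1) ∘ f))]] at h
  refine Module.Basis.ext_alternating (Pi.basisFun ℝ _) fun f _ => ?_
  have := h f (Finset.mem_univ f)
  simpa [Function.comp_def] using this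

theorem exists_wedgeAlt_sympAlt_eq {α : SympVec (2 + k) [⋀^Fin (2 + k)]→ₗ[ℝ] ℝ}
    (hα : ∀ S : Fin (2 + k) → Fin (2 + k) → ℝ, (∀ i j, S i j = S j i) →
      α (fun i => qVec i + ∑ j, S i j • pVec j) = 0) :
    ∃ δ : SympVec (2 + k) [⋀^Fin k]→ₗ[ℝ] ℝ, wedgeAlt (sympAlt (2 + k)) δ = α := by
  obtain ⟨δ, hδ⟩ := exists_orthogonal_wedgeAlt (fun i => Pi.single i 1) (sympAlt (2 + k)) α
  refine ⟨δ, (sub_eq_zero.1 ?_).symm⟩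
  set g := α - wedgeAlt (sympAlt (2 + k)) δ with hg
  have hgc := contractAlt_eq_zero_of_orthogonal hδ
  have hgraph : ∀ S : Fin (2 + k) → Fin (2 + k) → ℝ, (∀ i j, S i j = S j i) →
      g (fun i => qVec i + ∑ j, S i j • pVec j) = 0 := by
    intro S hS
    have hsymp : ∀ i j, sympAlt (2 + k) ![qVec i + ∑ j, S i j • pVec j,
        qVec j + ∑ l, S j l • pVec l] = 0 := by
      intro i j
      simp [sympAlt_apply, Finset.sum_apply, Pi.single_apply, hS i j]
    rw [hg, AlternatingMap.sub_apply, hα S hS, wedgeAlt_apply, Finset.sum_eq_zero, mul_zero,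
      sub_zero]
    intro σ _
    rw [show (fun i : Fin 2 => qVec (σ (Fin.castAdd k i)) + ∑ j, S (σ (Fin.castAdd k i)) j • pVec j)
      = ![_, _] from List.ofFn_inj.1 rfl, hsymp]
    simp
  refine Module.Basis.ext_alternating (Pi.basisFun ℝ _) fun f _ => ?_
  refine eq_zero_of_effective_of_graphs qVec pVec (2 + k) Finset.univ Finset.univ g (by simp)
    (by simp) (fun a _ v x y => g.map_update_add v a x y)
    (fun v a _ b _ hab h => g.map_eq_zero_of_eq v h hab)
    (fun a _ b _ hab v => sum_update_eq_zero_of_contractAlt hgc hab v) ?_ _ ?_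
  · intro S hS _ β hβ v hv
    have hβ' : Function.Bijective β := by simpa [Set.bijOn_univ] using hβ
    have : v = (fun i => qVec i + ∑ j, S i j • pVec j) ∘ Equiv.ofBijective β hβ' :=
      funext fun a => hv a (Finset.mem_univ a)
    rw [this, g.map_perm, hgraph S hS, smul_zero]
  · intro a _
    refine ⟨(f a).1, Finset.mem_univ _, ?_⟩
    rcases h : f a with ⟨i, _ | _⟩ <;> simp

end Symplectic

section Jets

variable {n : ℕ}

theorem idx_cases (i : Fin (2 * n + 1)) :
    (∃ μ : Fin n, i = qIdx μ) ∨ i = uIdx ∨ ∃ μ : Fin n, i = pIdx μ := by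
  rcases lt_trichotomy (i : ℕ) n with h | h | h
  · exact .inl ⟨⟨i, h⟩, rfl⟩
  · exact .inr (.inl (Fin.ext h))
  · refine .inr (.inr ⟨⟨i - (n + 1), by have := i.isLt; omega⟩, Fin.ext ?_⟩)
    simp only [pIdx]
    omega

theorem jet_qIdx (φ : Vec n → ℝ) (y : Vec n) (μ : Fin n) : jet φ y (qIdx μ) = y μ := by
  simp [jet, qIdx]

theorem jet_uIdx (φ : Vec n → ℝ) (y : Vec n) : jet φ y uIdx = φ y := by
  simp [jet, uIdx]

theorem jet_pIdx (φ : Vec n → ℝ) (y : Vec n) (μ : Fin n) :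
    jet φ y (pIdx μ) = fderiv ℝ φ y (basisVec μ) := by
  have h1 : ¬ (n + 1 + (μ : ℕ) < n) := by omega
  have h2 : ¬ (n + 1 + (μ : ℕ) = n) := by omega
  simp [jet, pIdx, h1, h2]

theorem sum_mul_basisVec (L : Vec n →L[ℝ] ℝ) (v : Vec n) : ∑ μ, v μ * L (basisVec μ) = L v := by
  have h : v = ∑ μ, v μ • (basisVec μ : Vec n) := by
    ext i
    simp [basisVec, Finset.sum_apply, Pi.single_apply]
  conv_rhs => rw [h]
  simp

theorem contDiff_jet {φ : Vec n → ℝ} (hφ : ContDiff ℝ (⊤ : ℕ∞) φ) :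
    ContDiff ℝ (⊤ : ℕ∞) (jet φ) := by
  refine contDiff_pi.2 fun i => ?_
  rcases idx_cases i with ⟨μ, rfl⟩ | rfl | ⟨μ, rfl⟩
  · simpa only [jet_qIdx] using contDiff_apply ℝ ℝ μ
  · simpa only [jet_uIdx] using hφ
  · simp only [jet_pIdx]
    exact (hφ.fderiv_right (by simp)).clm_apply contDiff_const

theorem fderiv_jet_apply {φ : Vec n → ℝ} (hφ : ContDiff ℝ (⊤ : ℕ∞) φ) (y v : Vec n)
    (i : Fin (2 * n + 1)) :
    fderiv ℝ (jet φ) y v i = fderiv ℝ (fun z => jet φ z i) y v := by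
  have h := ((contDiff_jet hφ).differentiable (by simp)) y
  rw [fderiv_pi fun i => (differentiableAt_pi.1 h i)]
  rfl

theorem fderiv_jet_qIdx {φ : Vec n → ℝ} (hφ : ContDiff ℝ (⊤ : ℕ∞) φ) (y v : Vec n) (μ : Fin n) :
    fderiv ℝ (jet φ) y v (qIdx μ) = v μ := by
  simp only [fderiv_jet_apply hφ, jet_qIdx]
  rw [(hasFDerivAt_apply μ y).fderiv]
  rfl

theorem fderiv_jet_uIdx {φ : Vec n → ℝ} (hφ : ContDiff ℝ (⊤ : ℕ∞) φ) (y v : Vec n) :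
    fderiv ℝ (jet φ) y v uIdx = fderiv ℝ φ y v := by
  simp only [fderiv_jet_apply hφ, jet_uIdx]

theorem fderiv_jet_pIdx {φ : Vec n → ℝ} (hφ : ContDiff ℝ (⊤ : ℕ∞) φ) (y v : Vec n) (μ : Fin n) :
    fderiv ℝ (jet φ) y v (pIdx μ) = fderiv ℝ (fderiv ℝ φ) y v (basisVec μ) := by
  simp only [fderiv_jet_apply hφ, jet_pIdx]
  have h : DifferentiableAt ℝ (fderiv ℝ φ) y :=
    ((hφ.fderiv_right (m := (⊤ : ℕ∞)) (by simp)).differentiable (by simp)) y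
  rw [fderiv_clm_apply h (by fun_prop)]
  simp

/-- The components of a tangent vector along the `q^μ` and the `p_μ`. -/
def toSymp (n : ℕ) : Vec (2 * n + 1) →ₗ[ℝ] SympVec n :=
  LinearMap.funLeft ℝ ℝ fun i => if i.2 then pIdx i.1 else qIdx i.1

theorem toSymp_false (v : Vec (2 * n + 1)) (μ : Fin n) : toSymp n v (μ, false) = v (qIdx μ) := by
  simp [toSymp, LinearMap.funLeft_apply]

theorem toSymp_true (v : Vec (2 * n + 1)) (μ : Fin n) : toSymp n v (μ, true) = v (pIdx μ) := by
  simp [toSymp, LinearMap.funLeft_apply]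

/-- The contact form at a point, as a linear functional. -/
def contactLin (x : Vec (2 * n + 1)) : Vec (2 * n + 1) →ₗ[ℝ] ℝ :=
  LinearMap.proj uIdx - ∑ μ : Fin n, x (pIdx μ) • LinearMap.proj (qIdx μ)

theorem contactLin_apply (x v : Vec (2 * n + 1)) :
    contactLin x v = v uIdx - ∑ μ : Fin n, x (pIdx μ) * v (qIdx μ) := by
  simp [contactLin]

theorem contact_apply (x : Vec (2 * n + 1)) (v : Fin 1 → Vec (2 * n + 1)) :
    contact x v = contactLin x (v 0) := (contactLin_apply x _).symm

/-- The isomorphism of `SympVec n` with the contact hyperplane at `x`. -/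
def contactLift (x : Vec (2 * n + 1)) : SympVec n →ₗ[ℝ] Vec (2 * n + 1) :=
  ∑ μ : Fin n, ((LinearMap.proj (μ, false)).smulRight
      (basisVec (qIdx μ) + x (pIdx μ) • basisVec uIdx) +
    (LinearMap.proj (μ, true)).smulRight (basisVec (pIdx μ)))

theorem contactLift_apply (x : Vec (2 * n + 1)) (w : SympVec n) :
    contactLift x w = ∑ μ : Fin n, (w (μ, false) • (basisVec (qIdx μ) +
      x (pIdx μ) • basisVec uIdx) + w (μ, true) • basisVec (pIdx μ)) := by
  simp [contactLift, LinearMap.sum_apply]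

theorem qIdx_inj {μ ν : Fin n} : qIdx μ = qIdx ν ↔ μ = ν := by simp [qIdx, Fin.ext_iff]

theorem pIdx_inj {μ ν : Fin n} : pIdx μ = pIdx ν ↔ μ = ν := by simp [pIdx, Fin.ext_iff]

theorem qIdx_ne_uIdx (μ : Fin n) : qIdx μ ≠ uIdx := by
  have := μ.isLt
  simp only [qIdx, uIdx, ne_eq, Fin.ext_iff]
  omega

theorem pIdx_ne_uIdx (μ : Fin n) : pIdx μ ≠ uIdx := by
  simp only [pIdx, uIdx, ne_eq, Fin.ext_iff]
  omega

theorem qIdx_ne_pIdx (μ ν : Fin n) : qIdx μ ≠ pIdx ν := by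
  have := μ.isLt
  simp only [qIdx, pIdx, ne_eq, Fin.ext_iff]
  omega

theorem contactLift_qIdx (x : Vec (2 * n + 1)) (w : SympVec n) (μ : Fin n) :
    contactLift x w (qIdx μ) = w (μ, false) := by
  simp [contactLift_apply, Finset.sum_apply, basisVec, Pi.single_apply, qIdx_inj, qIdx_ne_uIdx,
    qIdx_ne_pIdx]

theorem contactLift_uIdx (x : Vec (2 * n + 1)) (w : SympVec n) :
    contactLift x w uIdx = ∑ μ, x (pIdx μ) * w (μ, false) := by
  simp [contactLift_apply, Finset.sum_apply, basisVec, (qIdx_ne_uIdx _).symm,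
    (pIdx_ne_uIdx _).symm, mul_comm]

theorem contactLift_pIdx (x : Vec (2 * n + 1)) (w : SympVec n) (μ : Fin n) :
    contactLift x w (pIdx μ) = w (μ, true) := by
  simp [contactLift_apply, Finset.sum_apply, basisVec, Pi.single_apply, pIdx_inj, pIdx_ne_uIdx,
    (qIdx_ne_pIdx _ _).symm]

theorem contactLift_toSymp (x v : Vec (2 * n + 1)) :
    contactLift x (toSymp n v) = v - contactLin x v • chi := by
  ext i
  rcases idx_cases i with ⟨μ, rfl⟩ | rfl | ⟨μ, rfl⟩
  · simp [contactLift_qIdx, toSymp_false, chi, basisVec, qIdx_ne_uIdx]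
  · simp [contactLift_uIdx, toSymp_false, chi, basisVec, contactLin_apply]
  · simp [contactLift_pIdx, toSymp_true, chi, basisVec, pIdx_ne_uIdx]

theorem exd_contact_apply (x : Vec (2 * n + 1)) (v : Fin 2 → Vec (2 * n + 1)) :
    exd contact x v = sympAlt n fun i => toSymp n (v i) := by
  have h : ∀ w : Vec (2 * n + 1), ∀ z : Vec (2 * n + 1),
      fderiv ℝ (fun y => contact y fun _ : Fin 1 => w) x z =
        - ∑ μ : Fin n, z (pIdx μ) * w (qIdx μ) := by
    intro w z
    have : HasFDerivAt (fun y : Vec (2 * n + 1) => contact y fun _ : Fin 1 => w)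
        (-∑ μ : Fin n, (w (qIdx μ)) • (ContinuousLinearMap.proj (R := ℝ)
          (φ := fun _ : Fin (2 * n + 1) => ℝ) (pIdx μ))) x := by
      refine (HasFDerivAt.fun_sum fun μ _ => ?_).const_sub _
      exact (hasFDerivAt_apply (pIdx μ) x).mul_const _
    rw [this.fderiv]
    simp [mul_comm]
  have h0 : (fun j : Fin 1 => v ((0 : Fin 2).succAbove j)) = fun _ => v 1 := by
    ext1 j; fin_cases j; rfl
  have h1 : (fun j : Fin 1 => v ((1 : Fin 2).succAbove j)) = fun _ => v 0 := by
    ext1 j; fin_cases j; rfl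
  simp only [exd]
  rw [Fin.sum_univ_two, h0, h1, h, h, sympAlt_apply]
  simp only [toSymp_false, toSymp_true, Finset.sum_sub_distrib]
  simp only [mul_comm]
  simp
  ring

theorem contactLin_fderiv_jet {φ : Vec n → ℝ} (hφ : ContDiff ℝ (⊤ : ℕ∞) φ) (y v : Vec n) :
    contactLin (jet φ y) (fderiv ℝ (jet φ) y v) = 0 := by
  simp only [contactLin_apply, fderiv_jet_uIdx hφ, jet_pIdx, fderiv_jet_qIdx hφ]
  rw [← sum_mul_basisVec (fderiv ℝ φ y) v, sub_eq_zero]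
  simp only [mul_comm]

theorem sympAlt_fderiv_jet {φ : Vec n → ℝ} (hφ : ContDiff ℝ (⊤ : ℕ∞) φ) (y : Vec n)
    (v : Fin 2 → Vec n) : sympAlt n (fun i => toSymp n (fderiv ℝ (jet φ) y (v i))) = 0 := by
  simp only [sympAlt_apply, toSymp_false, toSymp_true, fderiv_jet_qIdx hφ, fderiv_jet_pIdx hφ,
    Finset.sum_sub_distrib]
  rw [sum_mul_basisVec]
  simp only [mul_comm _ (v 1 _)]
  rw [sum_mul_basisVec, sub_eq_zero]
  have : IsSymmSndFDerivAt ℝ φ y := hφ.contDiffAt.isSymmSndFDerivAt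
    (by simpa using WithTop.coe_le_coe.2 (le_top : (2 : ℕ∞) ≤ ⊤))
  exact this _ _

/-- The quadratic function with prescribed `1`-jet `x` and Hessian `S`. -/
def quadratic (x : Vec (2 * n + 1)) (S : Fin n → Fin n → ℝ) (y : Vec n) : ℝ :=
  x uIdx + ∑ μ, x (pIdx μ) * (y μ - x (qIdx μ)) +
    2⁻¹ * ∑ μ, ∑ ν, S μ ν * ((y μ - x (qIdx μ)) * (y ν - x (qIdx ν)))

theorem contDiff_quadratic (x : Vec (2 * n + 1)) (S : Fin n → Fin n → ℝ) :
    ContDiff ℝ (⊤ : ℕ∞) (quadratic x S) := by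
  unfold quadratic
  fun_prop

theorem fderiv_quadratic (x : Vec (2 * n + 1)) {S : Fin n → Fin n → ℝ}
    (hS : ∀ μ ν, S μ ν = S ν μ) (y : Vec n) (μ : Fin n) :
    fderiv ℝ (quadratic x S) y (basisVec μ) =
      x (pIdx μ) + ∑ ν, S μ ν * (y ν - x (qIdx ν)) := by
  have hp : ∀ μ, HasFDerivAt (fun y : Vec n => y μ - x (qIdx μ))
      (ContinuousLinearMap.proj (R := ℝ) (φ := fun _ : Fin n => ℝ) μ) y := fun μ =>
    (hasFDerivAt_apply μ y).sub_const _
  have h : HasFDerivAt (quadratic x S) _ y :=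
    ((HasFDerivAt.fun_sum fun μ _ => (hp μ).const_mul (x (pIdx μ))).const_add (x uIdx)).add
      ((HasFDerivAt.fun_sum fun μ _ => HasFDerivAt.fun_sum fun ν _ =>
        ((hp μ).mul (hp ν)).const_mul (S μ ν)).const_mul 2⁻¹)
  rw [h.fderiv]
  simp [basisVec, Pi.single_apply, Finset.sum_add_distrib]
  simp only [hS _ μ]
  ring

theorem jet_quadratic (x : Vec (2 * n + 1)) {S : Fin n → Fin n → ℝ}
    (hS : ∀ μ ν, S μ ν = S ν μ) : jet (quadratic x S) (fun μ => x (qIdx μ)) = x := by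
  ext i
  rcases idx_cases i with ⟨μ, rfl⟩ | rfl | ⟨μ, rfl⟩
  · rw [jet_qIdx]
  · simp [jet_uIdx, quadratic]
  · simp [jet_pIdx, fderiv_quadratic x hS]

theorem fderiv_jet_quadratic (x : Vec (2 * n + 1)) {S : Fin n → Fin n → ℝ}
    (hS : ∀ μ ν, S μ ν = S ν μ) (μ : Fin n) :
    fderiv ℝ (jet (quadratic x S)) (fun μ => x (qIdx μ)) (basisVec μ) =
      contactLift x (qVec μ + ∑ ν, S μ ν • pVec ν) := by
  have hφ := contDiff_quadratic x S
  ext i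
  rcases idx_cases i with ⟨ν, rfl⟩ | rfl | ⟨ν, rfl⟩
  · simp [fderiv_jet_qIdx hφ, contactLift_qIdx, basisVec, Pi.single_apply, Finset.sum_apply]
  · simp [fderiv_jet_uIdx hφ, contactLift_uIdx, fderiv_quadratic x hS, Pi.single_apply,
      Finset.sum_apply]
  · rw [fderiv_jet_apply hφ]
    simp only [jet_pIdx, fderiv_quadratic x hS]
    have hp : ∀ κ, HasFDerivAt (fun y : Vec n => y κ - x (qIdx κ))
        (ContinuousLinearMap.proj (R := ℝ) (φ := fun _ : Fin n => ℝ) κ) (fun μ => x (qIdx μ)) :=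
      fun κ => (hasFDerivAt_apply κ _).sub_const _
    have h : HasFDerivAt (fun y : Vec n => x (pIdx ν) + ∑ κ, S ν κ * (y κ - x (qIdx κ))) _
        (fun μ => x (qIdx μ)) :=
      (HasFDerivAt.fun_sum fun κ _ => (hp κ).const_mul (S ν κ)).const_add (x (pIdx ν))
    rw [h.fderiv]
    simp [contactLift_pIdx, basisVec, Pi.single_apply,
      Finset.sum_apply, hS ν μ]

end Jets

section Contraction

open scoped Nat

variable {V : Type*} [AddCommGroup V] [Module ℝ V] {j : ℕ}

theorem sum_perm_apply {m : ℕ} (hm : m = j + 1) (z : Fin m) (hz : (z : ℕ) = 0) (h : Fin m → ℝ) :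
    ∑ σ : Equiv.Perm (Fin m), h (σ z) = (j ! : ℝ) * ∑ i, h i := by
  subst hm
  obtain rfl : z = 0 := Fin.ext hz
  rw [← Equiv.Perm.decomposeFin.symm.sum_comp, Fintype.sum_prod_type]
  simp [Equiv.Perm.decomposeFin_symm_apply_zero, Fintype.card_perm, Finset.mul_sum]

theorem map_sub_smul_eq {ι : Type*} [Fintype ι] [DecidableEq ι] (a : V [⋀^ι]→ₗ[ℝ] ℝ) (c : ι → ℝ)
    (χ : V) (v : ι → V) :
    a (fun i => v i - c i • χ) = a v - ∑ i, c i * a (Function.update v i χ) := by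
  have h := a.toMultilinearMap.map_add_eq_map_add_linearDeriv_add v fun i => -(c i • χ)
  rw [Finset.sum_eq_zero, add_zero, MultilinearMap.linearDeriv_apply] at h
  · simp only [AlternatingMap.coe_multilinearMap] at h
    have h' : (fun i => v i - c i • χ) = v + fun i => -(c i • χ) := by
      ext1 i
      exact sub_eq_add_neg _ _
    rw [h', h, sub_eq_add_neg, ← Finset.sum_neg_distrib]
    simp only [← neg_smul, AlternatingMap.map_update_smul, smul_eq_mul, neg_mul]
  · intro s hs
    obtain ⟨p, hp, q, hq, hpq⟩ := Finset.one_lt_card.1 (Finset.mem_filter.1 hs).2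
    have h1 : (s.piecewise (fun i => -(c i • χ)) v) =
        fun i => (s.piecewise (fun i => -c i) 1) i • (s.piecewise (fun _ => χ) v) i := by
      ext1 i
      by_cases hi : i ∈ s <;> simp [hi]
    rw [h1, MultilinearMap.map_smul_univ, AlternatingMap.coe_multilinearMap,
      a.map_eq_zero_of_eq _ (i := p) (j := q) (by simp [hp, hq]) hpq, smul_zero]

/-- Contraction of an alternating map with a vector. -/
def insertLeft (a : V [⋀^Fin (1 + j)]→ₗ[ℝ] ℝ) (χ : V) : V [⋀^Fin j]→ₗ[ℝ] ℝ :=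
  (a.domDomCongr (finCongr (Nat.add_comm 1 j))).curryLeft χ

theorem insertLeft_apply (a : V [⋀^Fin (1 + j)]→ₗ[ℝ] ℝ) (χ : V) (v : Fin j → V) :
    insertLeft a χ v = a fun i => Matrix.vecCons χ v (Fin.cast (Nat.add_comm 1 j) i) := rfl

theorem apply_eq_wedgeAlt_insertLeft_add (a : V [⋀^Fin (1 + j)]→ₗ[ℝ] ℝ) (θ : V →ₗ[ℝ] ℝ) (χ : V)
    (v : Fin (1 + j) → V) :
    a v = wedgeAlt (AlternatingMap.ofSubsingleton ℝ V ℝ (0 : Fin 1) θ) (insertLeft a χ) v +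
      a fun i => v i - θ (v i) • χ := by
  rw [map_sub_smul_eq, wedgeAlt_apply]
  have h : ∀ σ : Equiv.Perm (Fin (1 + j)), ((Equiv.Perm.sign σ : ℤ) : ℝ) *
      (AlternatingMap.ofSubsingleton ℝ V ℝ (0 : Fin 1) θ fun i => v (σ (Fin.castAdd j i))) *
        (insertLeft a χ fun i => v (σ (Fin.natAdd 1 i))) =
      θ (v (σ (Fin.castAdd j 0))) * a (Function.update v (σ (Fin.castAdd j 0)) χ) := by
    intro σ
    have h1 : (fun i => Matrix.vecCons χ (fun i => v (σ (Fin.natAdd 1 i)))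
        (Fin.cast (Nat.add_comm 1 j) i)) = Function.update v (σ (Fin.castAdd j 0)) χ ∘ σ := by
      ext1 i
      refine Fin.addCases (fun i => ?_) (fun i => ?_) i
      · obtain rfl : i = 0 := Subsingleton.elim _ _
        have : Fin.cast (Nat.add_comm 1 j) (Fin.castAdd j 0) = 0 := rfl
        simp [this]
      · have : Fin.cast (Nat.add_comm 1 j) (Fin.natAdd 1 i) = i.succ := by
          ext; simp
        have hne : Fin.natAdd 1 i ≠ Fin.castAdd j (0 : Fin 1) := by
          simp [Fin.ext_iff]
        rw [this]
        simp [hne]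
    rw [insertLeft_apply, h1, AlternatingMap.map_perm]
    have h2 : ((Equiv.Perm.sign σ : ℤ) : ℝ) * ((Equiv.Perm.sign σ : ℤ) : ℝ) = 1 := by
      rw [← Int.cast_mul, ← Units.val_mul]
      simp
    simp only [Units.smul_def, zsmul_eq_mul, AlternatingMap.ofSubsingleton_apply_apply]
    linear_combination (θ (v (σ (Fin.castAdd j 0))) *
      a (Function.update v (σ (Fin.castAdd j 0)) χ)) * h2
  rw [Finset.sum_congr rfl fun σ _ => h σ,
    sum_perm_apply (Nat.add_comm 1 j) (Fin.castAdd j 0) rfl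
      fun i => θ (v i) * a (Function.update v i χ)]
  have : (j ! : ℝ) ≠ 0 := by positivity
  simp
  field_simp
  ring

end Contraction

section Ideal

theorem exists_linear_wedgeAlt_section {V ι : Type*} [AddCommGroup V] [Module ℝ V] {k : ℕ} (l : ℕ)
    (e : Module.Basis ι ℝ V) (a : V [⋀^Fin k]→ₗ[ℝ] ℝ) :
    ∃ s : ((Fin (k + l) → ι) → ℝ) →ₗ[ℝ] V [⋀^Fin l]→ₗ[ℝ] ℝ,
      ∀ δ, wedgeAlt a (s fun f => wedgeAlt a δ (e ∘ f)) = wedgeAlt a δ := by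
  let T := altCoords e (k + l) ∘ₗ wedgeAltLeft l a
  obtain ⟨g, hg⟩ := T.rangeRestrict.exists_rightInverse_of_surjective T.range_rangeRestrict
  obtain ⟨s, hs⟩ := g.exists_extend
  refine ⟨s, fun δ => altCoords_injective e ?_⟩
  have h1 := congrArg Subtype.val (LinearMap.congr_fun hg (T.rangeRestrict δ))
  rwa [← hs] at h1

theorem contDiff_form_apply {m k : ℕ} {ω : Form m k} (hω : IsForm ω) (hωs : SmoothForm ω)
    {w : Fin k → Vec m → Vec m} (hw : ∀ i, ContDiff ℝ (⊤ : ℕ∞) (w i)) :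
    ContDiff ℝ (⊤ : ℕ∞) fun x => ω x fun i => w i x := by
  have h : ∀ x, (ω x fun i => w i x) = ∑ f : Fin k → Fin m,
      (∏ i, w i x (f i)) * ω x fun i => basisVec (f i) := by
    intro x
    obtain ⟨a, ha⟩ := hω x
    have h1 : (fun i => w i x) = fun i => ∑ μ, w i x μ • (basisVec μ : Vec m) := by
      ext i κ
      simp [basisVec, Finset.sum_apply, Pi.single_apply]
    rw [ha, h1, ← AlternatingMap.coe_multilinearMap, MultilinearMap.map_sum]
    refine Finset.sum_congr rfl fun f _ => ?_
    rw [MultilinearMap.map_smul_univ, ha]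
    rfl
  simp only [h]
  refine ContDiff.sum fun f _ => (contDiff_prod fun i _ => ?_).mul (hωs _)
  exact (contDiff_apply ℝ ℝ (f i)).comp (hw i)

variable {n : ℕ}

theorem contact_eq_ofSubsingleton (x : Vec (2 * n + 1)) (v : Fin 1 → Vec (2 * n + 1)) :
    contact x v = AlternatingMap.ofSubsingleton ℝ (Vec (2 * n + 1)) ℝ (0 : Fin 1)
      (contactLin x) v := contact_apply x v

theorem exists_eq_wedge_contact_add {m j : ℕ} {ω : Form (2 * m + 1) (1 + j)} (hω : IsForm ω)
    (hωs : SmoothForm ω) : ∃ γ : Form (2 * m + 1) j, IsForm γ ∧ SmoothForm γ ∧ ∀ x v,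
      ω x v = wedge contact γ x v + ω x fun i => contactLift x (toSymp m (v i)) := by
  refine ⟨fun x v => ω x fun i => Matrix.vecCons chi v (Fin.cast (Nat.add_comm 1 j) i),
    fun x => ?_, fun v => hωs _, fun x v => ?_⟩
  · obtain ⟨a, ha⟩ := hω x
    exact ⟨insertLeft a chi, fun v => ha _⟩
  · obtain ⟨a, ha⟩ := hω x
    rw [wedge_eq_wedgeAlt (contact_eq_ofSubsingleton x) (b := insertLeft a chi) (fun v => ha _),
      ha, ha]
    simp only [contactLift_toSymp]
    exact apply_eq_wedgeAlt_insertLeft_add a (contactLin x) chi v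

theorem exd_contact_eq_compLinearMap (x : Vec (2 * n + 1)) (v : Fin 2 → Vec (2 * n + 1)) :
    exd contact x v = (sympAlt n).compLinearMap (toSymp n) v := exd_contact_apply x v

theorem contDiff_contactLift (w : SympVec n) :
    ContDiff ℝ (⊤ : ℕ∞) fun x : Vec (2 * n + 1) => contactLift x w := by
  simp only [contactLift_apply]
  fun_prop

theorem exists_contactLift_eq_wedge_exd {k : ℕ} {ω : Form (2 * (2 + k) + 1) (2 + k)}
    (hω : IsForm ω) (hωs : SmoothForm ω)
    (h : ∀ φ : Vec (2 + k) → ℝ, ContDiff ℝ (⊤ : ℕ∞) φ → pullback (jet φ) ω = 0) :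
    ∃ δ : Form (2 * (2 + k) + 1) k, IsForm δ ∧ SmoothForm δ ∧ ∀ x v,
      (ω x fun i => contactLift x (toSymp (2 + k) (v i))) = wedge (exd contact) δ x v := by
  let e := Pi.basisFun ℝ (Fin (2 + k) × Bool)
  obtain ⟨s, hs⟩ := exists_linear_wedgeAlt_section k e (sympAlt (2 + k))
  let c : Vec (2 * (2 + k) + 1) → (Fin (2 + k) → Fin (2 + k) × Bool) → ℝ := fun x f =>
    ω x fun i => contactLift x (e (f i))
  refine ⟨fun x v => s (c x) fun i => toSymp _ (v i),
    fun x => ⟨(s (c x)).compLinearMap (toSymp _), fun v => rfl⟩, fun v => ?_, fun x v => ?_⟩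
  · have h1 : ∀ x, (s (c x) fun i => toSymp _ (v i)) = ∑ f, c x f *
        (s fun g => if f = g then 1 else 0) fun i => toSymp _ (v i) := by
      let ev : (SympVec (2 + k) [⋀^Fin k]→ₗ[ℝ] ℝ) →ₗ[ℝ] ℝ :=
        { toFun := fun b => b fun i => toSymp _ (v i)
          map_add' := fun _ _ => rfl
          map_smul' := fun _ _ => rfl }
      exact fun x => LinearMap.pi_apply_eq_sum_univ (ev ∘ₗ s) (c x)
    simp only [h1]
    exact ContDiff.sum fun f _ =>
      (contDiff_form_apply hω hωs fun i => contDiff_contactLift _).mul contDiff_const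
  · obtain ⟨a, ha⟩ := hω x
    obtain ⟨δ, hδ⟩ := exists_wedgeAlt_sympAlt_eq (α := a.compLinearMap (contactLift x)) (by
      intro S hS
      have h1 := congrFun (congrFun (h _ (contDiff_quadratic x S)) fun μ => x (qIdx μ)) basisVec
      simp only [pullback, jet_quadratic x hS, fderiv_jet_quadratic x hS, ha] at h1
      exact h1)
    have hc : c x = fun f => wedgeAlt (sympAlt (2 + k)) δ (e ∘ f) := by
      ext f
      rw [hδ]
      exact ha _
    rw [wedge_eq_wedgeAlt (exd_contact_eq_compLinearMap x)
      (b := (s (c x)).compLinearMap (toSymp _)) (fun v => rfl)]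
    trans wedgeAlt (sympAlt (2 + k)) (s (c x)) fun i => toSymp _ (v i)
    · rw [hc, hs, hδ]
      exact ha _
    · simp only [wedgeAlt_apply]
      rfl

theorem wedge_contact_fderiv_jet {j : ℕ} (γ : Form (2 * n + 1) j) {φ : Vec n → ℝ}
    (hφ : ContDiff ℝ (⊤ : ℕ∞) φ) (y : Vec n) (v : Fin (1 + j) → Vec n) :
    wedge contact γ (jet φ y) (fun i => fderiv ℝ (jet φ) y (v i)) = 0 := by
  simp [wedge, contact_apply, contactLin_fderiv_jet hφ]

theorem wedge_exd_contact_fderiv_jet {j : ℕ} (δ : Form (2 * n + 1) j) {φ : Vec n → ℝ}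
    (hφ : ContDiff ℝ (⊤ : ℕ∞) φ) (y : Vec n) (v : Fin (2 + j) → Vec n) :
    wedge (exd contact) δ (jet φ y) (fun i => fderiv ℝ (jet φ) y (v i)) = 0 := by
  simp [wedge, exd_contact_apply, sympAlt_fderiv_jet hφ]

theorem exists_wedge_contact_eq {m j N : ℕ} (hj : 1 + j = N) {ω : Form (2 * m + 1) N}
    (hω : IsForm ω) (hωs : SmoothForm ω) : ∃ γ : Form (2 * m + 1) j, IsForm γ ∧ SmoothForm γ ∧
      ∀ x v, ω x v = reindex hj (wedge contact γ) x v +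
        ω x fun i => contactLift x (toSymp m (v i)) := by
  subst hj
  exact exists_eq_wedge_contact_add hω hωs

theorem exists_wedge_exd_contact_eq {k : ℕ} (hk : 2 + k = n) {ω : Form (2 * n + 1) n}
    (hω : IsForm ω) (hωs : SmoothForm ω)
    (h : ∀ φ : Vec n → ℝ, ContDiff ℝ (⊤ : ℕ∞) φ → pullback (jet φ) ω = 0) :
    ∃ δ : Form (2 * n + 1) k, IsForm δ ∧ SmoothForm δ ∧ ∀ x v,
      (ω x fun i => contactLift x (toSymp n (v i))) = reindex hk (wedge (exd contact) δ) x v := by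
  subst hk
  exact exists_contactLift_eq_wedge_exd hω hωs h

end Ideal

/-- an n-form `ω` on ℝ^{2n+1} pulls back to `0` along every first jet
prolongation `j¹φ` iff it lies in the ideal generated by the contact form `c` and `dc`,
i.e. iff `ω = c ∧ γ + dc ∧ δ` for some (n−1)-form `γ` and (n−2)-form `δ`. -/
theorem contact_ideal_characterization (n : ℕ) (hn : 2 ≤ n)
    (ω : Form (2 * n + 1) n) (hω : IsForm ω) (hωs : SmoothForm ω) :
    (∀ φ : Vec n → ℝ, ContDiff ℝ (⊤ : ℕ∞) φ → pullback (jet φ) ω = 0) ↔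
      ∃ (γ : Form (2 * n + 1) (n - 1)) (δ : Form (2 * n + 1) (n - 2)),
        IsForm γ ∧ SmoothForm γ ∧ IsForm δ ∧ SmoothForm δ ∧
        ω = reindex (show 1 + (n - 1) = n by omega) (wedge (contact (n := n)) γ) +
            reindex (show 2 + (n - 2) = n by omega) (wedge (exd (contact (n := n))) δ) := by
  constructor
  · intro h
    obtain ⟨γ, hγ, hγs, hγe⟩ := exists_wedge_contact_eq (show 1 + (n - 1) = n by omega) hω hωs
    obtain ⟨δ, hδ, hδs, hδe⟩ :=
      exists_wedge_exd_contact_eq (show 2 + (n - 2) = n by omega) hω hωs h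
    refine ⟨γ, δ, hγ, hγs, hδ, hδs, ?_⟩
    ext x v
    rw [hγe, hδe]
    rfl
  · rintro ⟨γ, δ, -, -, -, -, rfl⟩ φ hφ
    ext y v
    exact (congrArg₂ (· + ·) (wedge_contact_fderiv_jet γ hφ y _)
      (wedge_exd_contact_fderiv_jet δ hφ y _)).trans (add_zero 0)

end MA
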